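/- Let k be a field of characteristic 0 and q ∈ k nonzero, either generic (not a root of unity) or a primitive m-th root of unity. For 1 ≤ r ≤ n−1, the natural homomorphism π: A_{n,r} → M^{r+1}_q(n), obtained by restricting the quotient map M_q(n) → M_q(n)/I^{r+1}_q to the subalgebra A_{n,r}, is injective. -/

import Mathlib

open scoped BigOperators

/-- Defining relations of the quantized matrix algebra `M_q(n,r)` (generators `Z (i,j)`). -/
inductive QMatRel (k : Type) [Field k] (q : k) (n r : ℕ) :
    FreeAlgebra k (Fin n × Fin r) → FreeAlgebra k (Fin n × Fin r) → Prop
  | row (i : Fin n) (j l : Fin r) (h : j < l) :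
      QMatRel k q n r (FreeAlgebra.ι k (i, j) * FreeAlgebra.ι k (i, l))
        (q • (FreeAlgebra.ι k (i, l) * FreeAlgebra.ι k (i, j)))
  | col (i s : Fin n) (j : Fin r) (h : i < s) :
      QMatRel k q n r (FreeAlgebra.ι k (i, j) * FreeAlgebra.ι k (s, j))
        (q • (FreeAlgebra.ι k (s, j) * FreeAlgebra.ι k (i, j)))
  | cross (i s : Fin n) (j l : Fin r) (h1 : i < s) (h2 : l < j) :
      QMatRel k q n r (FreeAlgebra.ι k (i, j) * FreeAlgebra.ι k (s, l))
        (FreeAlgebra.ι k (s, l) * FreeAlgebra.ι k (i, j))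
  | diag (i s : Fin n) (j l : Fin r) (h1 : i < s) (h2 : j < l) :
      QMatRel k q n r (FreeAlgebra.ι k (i, j) * FreeAlgebra.ι k (s, l))
        (FreeAlgebra.ι k (s, l) * FreeAlgebra.ι k (i, j) +
          (q - q⁻¹) • (FreeAlgebra.ι k (i, l) * FreeAlgebra.ι k (s, j)))

/-- The quantized matrix algebra `M_q(n,r)`. -/
abbrev QMat (k : Type) [Field k] (q : k) (n r : ℕ) : Type := RingQuot (QMatRel k q n r)

/-- The generator `Z_{i,j}` of `M_q(n,r)`. -/
noncomputable def Zgen (k : Type) [Field k] (q : k) (n r : ℕ) (i : Fin n) (j : Fin r) :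
    QMat k q n r :=
  RingQuot.mkAlgHom k (QMatRel k q n r) (FreeAlgebra.ι k (i, j))

/-- Number of inversions (the length) of a permutation. -/
def invCount {t : ℕ} (σ : Equiv.Perm (Fin t)) : ℕ :=
  (Finset.univ.filter (fun p : Fin t × Fin t => p.1 < p.2 ∧ σ p.2 < σ p.1)).card

/-- The `t × t` quantum minor on rows `row 0 < ... < row (t-1)` and columns
`col 0 < ... < col (t-1)`. -/
noncomputable def qMinor (k : Type) [Field k] (q : k) (n r : ℕ) (t : ℕ)
    (row : Fin t → Fin n) (col : Fin t → Fin r) : QMat k q n r :=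
  ∑ σ : Equiv.Perm (Fin t),
    ((-q) ^ invCount σ) • (List.ofFn fun a => Zgen k q n r (row a) (col (σ a))).prod


/-- The set of all `t × t` quantum minors of `M_q(n)` (rows `ro 0 < ... < ro (t-1)`,
columns `co 0 < ... < co (t-1)`). -/
def minorSet (k : Type) [Field k] (q : k) (n t : ℕ) : Set (QMat k q n n) :=
  {x | ∃ ro co : Fin t → Fin n, StrictMono ro ∧ StrictMono co ∧ x = qMinor k q n n t ro co}

/-- The relation identifying every `t × t` quantum minor of `M_q(n)` with `0`; the
corresponding `RingQuot` is the quotient of `M_q(n)` by the two-sided ideal `I^t_q`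
generated by all `t × t` quantum minors. -/
def minorRel (k : Type) [Field k] (q : k) (n t : ℕ) :
    QMat k q n n → QMat k q n n → Prop :=
  fun a b => a ∈ minorSet k q n t ∧ b = 0

/-- The quantized function algebra `M^{r+1}_q(n) = M_q(n) / I^{r+1}_q` of rank `r`
matrices. -/
abbrev QMatRank (k : Type) [Field k] (q : k) (n r : ℕ) : Type :=
  RingQuot (minorRel k q n (r + 1))

/-- The quotient map `π : M_q(n) → M^{r+1}_q(n)`. -/
noncomputable def rankProj (k : Type) [Field k] (q : k) (n r : ℕ) :
    QMat k q n n →ₐ[k] QMatRank k q n r :=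
  RingQuot.mkAlgHom k (minorRel k q n (r + 1))

/-- The quantum minor `d = d_r`: the `r × r` quantum minor of `M_q(n)` on rows and
columns `1, ..., r`. -/
noncomputable def dMinor (k : Type) [Field k] (q : k) (n r : ℕ) (h : r ≤ n) :
    QMat k q n n :=
  qMinor k q n n r (fun a => Fin.castLE h a) (fun a => Fin.castLE h a)

/-- `q` is either generic (not a root of unity) or a primitive `m`-th root of unity for
some `m ≥ 1`. -/
def GenericOrRootOfUnity (k : Type) [Field k] (q : k) : Prop :=
  (∀ m : ℕ, 0 < m → q ^ m ≠ 1) ∨ ∃ m : ℕ, 0 < m ∧ IsPrimitiveRoot q m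

/-- The subalgebra `A_{n,r}` of `M_q(n)` generated by the `Z_{i,j}` with
`(i,j) ∉ {r+1, ..., n} × {r+1, ..., n}` (0-based: `i < r` or `j < r`). -/
def Asub (k : Type) [Field k] (q : k) (n r : ℕ) : Subalgebra k (QMat k q n n) :=
  Algebra.adjoin k
    {x | ∃ i j : Fin n, ((i : ℕ) < r ∨ (j : ℕ) < r) ∧ x = Zgen k q n n i j}

section MonomialOperators

/-- Exponents: a family of integers indexed by `ℤ × ℤ`, together with a weight. -/
abbrev QExp : Type := (ℤ × ℤ → ℤ) × ℤ

/-- The operator `e_β ↦ q ^ φ β • e_{β + v}`. -/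
noncomputable def monOp {k : Type} [Field k] (q : k) (v : QExp) (φ : QExp →+ ℤ) :
    Module.End k (QExp →₀ k) :=
  Finsupp.linearCombination k fun β => Finsupp.single (β + v) (q ^ φ β)

variable {k : Type} [Field k]

theorem monOp_single (q : k) (v : QExp) (φ : QExp →+ ℤ) (β : QExp) :
    monOp q v φ (Finsupp.single β 1) = Finsupp.single (β + v) (q ^ φ β) := by
  simp [monOp]

theorem monOp_mul_monOp {q : k} (hq : q ≠ 0) (v w : QExp) (φ ψ : QExp →+ ℤ) :
    monOp q v φ * monOp q w ψ = q ^ (φ w - ψ v) • (monOp q w ψ * monOp q v φ) := by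
  refine Finsupp.lhom_ext' fun β => LinearMap.ext_ring ?_
  have h : ∀ (v : QExp) (φ : QExp →+ ℤ) (β : QExp) (c : k),
      monOp q v φ (Finsupp.single β c) = Finsupp.single (β + v) (c * q ^ φ β) := by
    intro v φ β c
    simp [monOp]
  simp only [LinearMap.comp_apply, Finsupp.lsingle_apply, LinearMap.smul_apply,
    Module.End.mul_apply, h, map_add, Finsupp.smul_single, smul_eq_mul, one_mul]
  rw [add_right_comm, zpow_sub₀ hq, zpow_add₀ hq, zpow_add₀ hq]
  congr 1
  field_simp

theorem monOp_commute {q : k} (hq : q ≠ 0) {v w : QExp} {φ ψ : QExp →+ ℤ} (h : φ w = ψ v) :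
    Commute (monOp q v φ) (monOp q w ψ) := by
  rw [Commute, SemiconjBy, monOp_mul_monOp hq, h, sub_self, zpow_zero, one_smul]

/-- Vectors all of whose exponents have weight at least `w`. -/
def weightGE (k : Type) [Field k] (w : ℤ) : Submodule k (QExp →₀ k) :=
  Finsupp.supported k k {γ | w ≤ γ.2}

theorem weightGE_mono {w w' : ℤ} (h : w ≤ w') : weightGE k w' ≤ weightGE k w :=
  Finsupp.supported_mono fun _ hγ => h.trans hγ

theorem single_mem_weightGE {w : ℤ} {γ : QExp} (h : w ≤ γ.2) (c : k) :
    Finsupp.single γ c ∈ weightGE k w :=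
  Finsupp.single_mem_supported k c h

/-- `T` raises weights by at least `w`. -/
def RaisesBy (T : Module.End k (QExp →₀ k)) (w : ℤ) : Prop :=
  ∀ w', ∀ x ∈ weightGE k w', T x ∈ weightGE k (w' + w)

theorem RaisesBy.zero (w : ℤ) : RaisesBy (0 : Module.End k (QExp →₀ k)) w :=
  fun _ _ _ => by simp

theorem RaisesBy.mono {T : Module.End k (QExp →₀ k)} {w w' : ℤ} (h : RaisesBy T w)
    (hw : w' ≤ w) : RaisesBy T w' :=
  fun u x hx => weightGE_mono (by lia) (h u x hx)

theorem RaisesBy.mul {T S : Module.End k (QExp →₀ k)} {w w' : ℤ} (hT : RaisesBy T w)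
    (hS : RaisesBy S w') : RaisesBy (T * S) (w + w') := fun u x hx => by
  rw [Module.End.mul_apply, add_comm w, ← add_assoc]
  exact hT _ _ (hS _ _ hx)

theorem RaisesBy.sum {ι : Type} (s : Finset ι) {T : ι → Module.End k (QExp →₀ k)} {w : ℤ}
    (h : ∀ i ∈ s, RaisesBy (T i) w) : RaisesBy (∑ i ∈ s, T i) w := fun u x hx => by
  rw [LinearMap.sum_apply]
  exact Submodule.sum_mem _ fun i hi => h i hi u x hx

theorem RaisesBy.of_single {T : Module.End k (QExp →₀ k)} {w : ℤ}
    (h : ∀ β, T (Finsupp.single β 1) ∈ weightGE k (β.2 + w)) : RaisesBy T w := by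
  intro u x hx
  rw [← Finsupp.sum_single x, Finsupp.sum, map_sum]
  refine Submodule.sum_mem _ fun γ hγ => ?_
  rw [← mul_one (x γ), ← smul_eq_mul, ← Finsupp.smul_single, map_smul]
  have hu : u ≤ γ.2 := hx hγ
  exact Submodule.smul_mem _ _ (weightGE_mono (by lia) (h γ))

/-- `T` shifts every basis vector by `α`, up to a nonzero scalar and terms of larger weight. -/
def HasLowest (T : Module.End k (QExp →₀ k)) (α : QExp) : Prop :=
  ∀ β, ∃ c : k, c ≠ 0 ∧
    T (Finsupp.single β 1) - Finsupp.single (β + α) c ∈ weightGE k (β.2 + α.2 + 1)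

theorem HasLowest.raisesBy {T : Module.End k (QExp →₀ k)} {α : QExp} (h : HasLowest T α) :
    RaisesBy T α.2 := by
  refine RaisesBy.of_single fun β => ?_
  obtain ⟨c, -, hc⟩ := h β
  have := Submodule.add_mem _ (weightGE_mono (by lia) hc)
    (single_mem_weightGE (w := β.2 + α.2) (γ := β + α) le_rfl c)
  simpa using this

theorem HasLowest.one : HasLowest (1 : Module.End k (QExp →₀ k)) 0 :=
  fun β => ⟨1, one_ne_zero, by simp⟩

theorem HasLowest.mul {T S : Module.End k (QExp →₀ k)} {α α' : QExp} (hT : HasLowest T α)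
    (hS : HasLowest S α') : HasLowest (T * S) (α + α') := by
  intro β
  obtain ⟨c, hc0, hc⟩ := hS β
  obtain ⟨d, hd0, hd⟩ := hT (β + α')
  refine ⟨c * d, mul_ne_zero hc0 hd0, ?_⟩
  have h1 := hT.raisesBy _ _ hc
  have h2 := Submodule.smul_mem _ c hd
  have h3 := Submodule.add_mem _ (weightGE_mono (w := β.2 + (α + α').2 + 1)
    (by simp only [Prod.snd_add]; lia) h1)
    (weightGE_mono (w := β.2 + (α + α').2 + 1) (by simp only [Prod.snd_add]; lia) h2)
  convert h3 using 1
  rw [map_sub, smul_sub, ← map_smul, Finsupp.smul_single, Finsupp.smul_single,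
    Module.End.mul_apply, smul_eq_mul, smul_eq_mul, mul_one, add_assoc β, add_comm α']
  abel

theorem HasLowest.add {T S : Module.End k (QExp →₀ k)} {α : QExp} (hT : HasLowest T α)
    (hS : RaisesBy S (α.2 + 1)) : HasLowest (T + S) α := by
  intro β
  obtain ⟨c, hc0, hc⟩ := hT β
  refine ⟨c, hc0, ?_⟩
  have h1 := hS β.2 (Finsupp.single β 1) (single_mem_weightGE le_rfl 1)
  have h2 := Submodule.add_mem _ hc (weightGE_mono (w := β.2 + α.2 + 1) (by lia) h1)
  convert h2 using 1
  rw [LinearMap.add_apply]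
  abel

theorem HasLowest.sum {ι : Type} [Fintype ι] {T : ι → Module.End k (QExp →₀ k)} {α : QExp}
    (i₀ : ι) (h₀ : HasLowest (T i₀) α) (h : ∀ i, i ≠ i₀ → RaisesBy (T i) (α.2 + 1)) :
    HasLowest (∑ i, T i) α := by
  classical
  rw [← Finset.add_sum_erase _ _ (Finset.mem_univ i₀)]
  exact h₀.add (RaisesBy.sum _ fun i hi => h i (Finset.ne_of_mem_erase hi))

theorem HasLowest.monOp {q : k} (hq : q ≠ 0) (v : QExp) (φ : QExp →+ ℤ) :
    HasLowest (monOp q v φ) v :=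
  fun β => ⟨q ^ φ β, zpow_ne_zero _ hq, by simp [monOp_single]⟩

theorem HasLowest.list_prod {ι : Type} {T : ι → Module.End k (QExp →₀ k)} {α : ι → QExp}
    (h : ∀ i, HasLowest (T i) (α i)) (l : List ι) :
    HasLowest (l.map T).prod (l.map α).sum := by
  induction l with
  | nil => simpa using HasLowest.one
  | cons i l ih => simpa using (h i).mul ih

/-- Operators whose lowest shifts are pairwise distinct are linearly independent. -/
theorem eq_zero_of_hasLowest {ι : Type} {T : ι → Module.End k (QExp →₀ k)} {α : ι → QExp}
    (h : ∀ i, HasLowest (T i) (α i)) (hα : Function.Injective α) (c : ι →₀ k)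
    (hc : c.sum (fun i a => a • T i) = 0) : c = 0 := by
  classical
  by_contra hne
  obtain ⟨m, hm, hmin⟩ := c.support.exists_min_image (fun i => (α i).2)
    (Finsupp.support_nonempty_iff.2 hne)
  have key : ∀ i ∈ c.support, i ≠ m → (T i (Finsupp.single 0 1)) (α m) = 0 := by
    intro i hi him
    obtain ⟨d, -, hd⟩ := h i 0
    have h0 : (T i (Finsupp.single 0 1) - Finsupp.single (0 + α i) d) (α m) = 0 := by
      by_contra h0
      have h1 : (0 : QExp).2 + (α i).2 + 1 ≤ (α m).2 := hd (Finsupp.mem_support_iff.2 h0)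
      have h2 := hmin i hi
      simp only [Prod.snd_zero] at h1
      lia
    simpa [Finsupp.single_apply, hα.ne him] using h0
  have hz := congrArg (fun S : Module.End k (QExp →₀ k) => S (Finsupp.single 0 1) (α m)) hc
  simp only [Finsupp.sum, LinearMap.sum_apply, LinearMap.smul_apply, Finsupp.finsetSum_apply,
    Finsupp.smul_apply, LinearMap.zero_apply, Finsupp.coe_zero, Pi.zero_apply] at hz
  rw [Finset.sum_eq_single_of_mem m hm fun i hi him => by rw [key i hi him, smul_zero]] at hz
  obtain ⟨d, hd0, hd⟩ := h m 0
  have h0 : (T m (Finsupp.single 0 1) - Finsupp.single (0 + α m) d) (α m) = 0 := by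
    by_contra h0
    have h1 : (0 : QExp).2 + (α m).2 + 1 ≤ (α m).2 := hd (Finsupp.mem_support_iff.2 h0)
    simp only [Prod.snd_zero] at h1
    lia
  have h3 : (T m (Finsupp.single 0 1)) (α m) = d := by
    simpa [sub_eq_zero] using h0
  rw [h3, smul_eq_mul] at hz
  exact mul_ne_zero (Finsupp.mem_support_iff.1 hm) hd0 hz

end MonomialOperators

section QuantumMatrices

/-- The defining relations of quantum matrices for the entries of a square matrix. -/
structure IsQuantumMatrix {k : Type} [Field k] (q : k) {n : ℕ} {R : Type} [Ring R] [Algebra k R]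
    (Z : Matrix (Fin n) (Fin n) R) : Prop where
  row : ∀ i j l, j < l → Z i j * Z i l = q • (Z i l * Z i j)
  col : ∀ i s j, i < s → Z i j * Z s j = q • (Z s j * Z i j)
  cross : ∀ i s j l, i < s → l < j → Z i j * Z s l = Z s l * Z i j
  diag : ∀ i s j l, i < s → j < l →
    Z i j * Z s l = Z s l * Z i j + (q - q⁻¹) • (Z i l * Z s j)

variable {k : Type} [Field k] {q : k} {n : ℕ} {R : Type} [Ring R] [Algebra k R]

/-- The relations of quantum matrices in the uniform form `R Z₁ Z₂ = Z₂ Z₁ R`. -/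
def RMatrixRelation (q : k) (Z : Matrix (Fin n) (Fin n) R) : Prop :=
  ∀ i s j t, (if i = s then q else 1) • (Z i j * Z s t) +
      (if s < i then q - q⁻¹ else 0) • (Z s j * Z i t) =
    (if j = t then q else 1) • (Z s t * Z i j) +
      (if j < t then q - q⁻¹ else 0) • (Z s j * Z i t)

theorem IsQuantumMatrix.transpose {Z : Matrix (Fin n) (Fin n) R} (h : IsQuantumMatrix q Z) :
    IsQuantumMatrix q Z.transpose where
  row i j l hjl := h.col j l i hjl
  col i s j his := h.row j i s his
  cross i s j l his hlj := (h.cross l j s i hlj his).symm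
  diag i s j l his hjl := by
    simp only [Matrix.transpose_apply]
    rw [h.diag j l i s hjl his, h.cross j l s i hjl his]

theorem IsQuantumMatrix.rMatrixRelation (hq : q ≠ 0) {Z : Matrix (Fin n) (Fin n) R}
    (h : IsQuantumMatrix q Z) : RMatrixRelation q Z := by
  intro i s j t
  rcases lt_trichotomy i s with his | rfl | his <;> rcases lt_trichotomy j t with hjt | rfl | hjt
  · simp [his.ne, his.not_gt, hjt.ne, hjt, h.diag i s j t his hjt, h.cross i s t j his hjt]
  · simp [his.ne, his.not_gt, h.col i s j his]
  · simp [his.ne, his.not_gt, hjt.ne', hjt.not_gt, h.cross i s j t his hjt]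
  · simp [hjt.ne, hjt, h.row i j t hjt, smul_smul, sub_mul, sub_smul, hq]
  · simp
  · simp [hjt.ne', hjt.not_gt, h.row i t j hjt]
  · simp [his.ne', his, hjt.ne, hjt, h.cross s i t j his hjt]
  · simp [his.ne', his, h.col s i j his, smul_smul, sub_mul, sub_smul, hq]
  · simp [his.ne', his, hjt.ne', hjt.not_gt, h.diag s i t j his hjt]

theorem RMatrixRelation.isQuantumMatrix {Z : Matrix (Fin n) (Fin n) R}
    (h : RMatrixRelation q Z) : IsQuantumMatrix q Z where
  row i j l hjl := by
    have := h i i l j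
    simpa [hjl.ne', hjl.not_gt] using this.symm
  col i s j his := by
    have := h i s j j
    simpa [his.ne, his.not_gt] using this
  cross i s j l his hlj := by
    have := h i s j l
    simpa [his.ne, his.not_gt, hlj.ne', hlj.not_gt] using this
  diag i s j l his hjl := by
    have h1 := h i s j l
    have h2 := h i s l j
    simp only [his.ne, his.not_gt, hjl.ne, hjl, hjl.ne', hjl.not_gt, if_true, if_false, one_smul,
      zero_smul, add_zero] at h1 h2
    rw [h1, h2]

theorem RMatrixRelation.mul {X Y : Matrix (Fin n) (Fin n) R} (hX : RMatrixRelation q X)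
    (hY : RMatrixRelation q Y) (hXY : ∀ i j l m, Commute (X i j) (Y l m)) :
    RMatrixRelation q (X * Y) := by
  intro i s j t
  have expand : ∀ a b c d, (X * Y) a b * (X * Y) c d =
      ∑ u, ∑ v, (X a u * X c v) * (Y u b * Y v d) := by
    intro a b c d
    rw [Matrix.mul_apply, Matrix.mul_apply, Finset.sum_mul_sum]
    refine Finset.sum_congr rfl fun u _ => Finset.sum_congr rfl fun v _ => ?_
    exact (hXY c v u b).symm.mul_mul_mul_comm _ _
  have expand' : ∀ a b c d, (X * Y) a b * (X * Y) c d =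
      ∑ u, ∑ v, (X a v * X c u) * (Y v b * Y u d) := fun a b c d => by
    rw [expand, Finset.sum_comm]
  have hX' : ∀ u v, (if i = s then q else 1) • (X i u * X s v) +
      (if s < i then q - q⁻¹ else 0) • (X s u * X i v) =
    (if u = v then q else 1) • (X s v * X i u) +
      (if u < v then q - q⁻¹ else 0) • (X s u * X i v) := fun u v => hX i s u v
  have hY' : ∀ u v, (if j = t then q else 1) • (Y v t * Y u j) +
      (if j < t then q - q⁻¹ else 0) • (Y v j * Y u t) =
    (if u = v then q else 1) • (Y u j * Y v t) +
      (if v < u then q - q⁻¹ else 0) • (Y v j * Y u t) := fun u v => (hY u v j t).symm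
  have swap : ∑ u, ∑ v, (if u < v then q - q⁻¹ else 0) • ((X s u * X i v) * (Y u j * Y v t)) =
      ∑ u, ∑ v, (if v < u then q - q⁻¹ else 0) • ((X s v * X i u) * (Y v j * Y u t)) :=
    Finset.sum_comm
  calc _ = ∑ u, ∑ v, ((if i = s then q else 1) • (X i u * X s v) +
        (if s < i then q - q⁻¹ else 0) • (X s u * X i v)) * (Y u j * Y v t) := by
        rw [expand, expand]
        simp only [Finset.smul_sum, ← Finset.sum_add_distrib, add_mul, smul_mul_assoc]
    _ = ∑ u, ∑ v, (if u = v then q else 1) • ((X s v * X i u) * (Y u j * Y v t)) +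
        ∑ u, ∑ v, (if u < v then q - q⁻¹ else 0) • ((X s u * X i v) * (Y u j * Y v t)) := by
        simp only [hX', add_mul, smul_mul_assoc, Finset.sum_add_distrib]
    _ = ∑ u, ∑ v, (X s v * X i u) * ((if j = t then q else 1) • (Y v t * Y u j) +
        (if j < t then q - q⁻¹ else 0) • (Y v j * Y u t)) := by
        rw [swap]
        simp only [hY', mul_add, mul_smul_comm, Finset.sum_add_distrib]
    _ = _ := by
        rw [expand' s t i j, expand' s j i t]
        simp only [Finset.smul_sum, ← Finset.sum_add_distrib, mul_add, mul_smul_comm]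

theorem IsQuantumMatrix.mul (hq : q ≠ 0) {X Y : Matrix (Fin n) (Fin n) R}
    (hX : IsQuantumMatrix q X) (hY : IsQuantumMatrix q Y)
    (hXY : ∀ i j l m, Commute (X i j) (Y l m)) : IsQuantumMatrix q (X * Y) :=
  ((hX.rMatrixRelation hq).mul (hY.rMatrixRelation hq) hXY).isQuantumMatrix

theorem commute_matrix_mul {x : R} {A B : Matrix (Fin n) (Fin n) R}
    (hA : ∀ i j, Commute x (A i j)) (hB : ∀ i j, Commute x (B i j)) (i j : Fin n) :
    Commute x ((A * B) i j) := by
  rw [Matrix.mul_apply]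
  exact Commute.sum_right _ _ _ fun l _ => (hA i l).mul_right (hB l j)

end QuantumMatrices

section Minors

theorem lt_swap_iff_of_adjacent {t : ℕ} {a b : Fin t} (hab : (b : ℕ) = a + 1) {x y : Fin t}
    (h1 : ¬(x = a ∧ y = b)) (h2 : ¬(x = b ∧ y = a)) :
    Equiv.swap a b x < Equiv.swap a b y ↔ x < y := by
  simp only [Equiv.swap_apply_def, Fin.ext_iff, Fin.lt_def] at *
  split_ifs <;> lia

/-- Composing with an adjacent transposition of an ascent adds exactly one inversion. -/
theorem invCount_mul_swap {t : ℕ} (σ : Equiv.Perm (Fin t)) {a b : Fin t}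
    (hab : (b : ℕ) = a + 1) (hσ : σ a < σ b) :
    invCount (σ * Equiv.swap a b) = invCount σ + 1 := by
  classical
  have hlt : a < b := by rw [Fin.lt_def]; lia
  set e : Fin t × Fin t ≃ Fin t × Fin t := (Equiv.swap a b).prodCongr (Equiv.swap a b) with he
  have key : (Finset.univ.filter fun p : Fin t × Fin t =>
      p.1 < p.2 ∧ (σ * Equiv.swap a b) p.2 < (σ * Equiv.swap a b) p.1) =
      insert (a, b) ((Finset.univ.filter fun p : Fin t × Fin t =>
        p.1 < p.2 ∧ σ p.2 < σ p.1).map e.toEmbedding) := by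
    ext ⟨x, y⟩
    rw [Finset.mem_insert, Finset.mem_map_equiv, Finset.mem_filter, Finset.mem_filter]
    simp only [he, Finset.mem_univ, true_and, Equiv.Perm.mul_apply,
      Prod.mk.injEq, Equiv.prodCongr_symm, Equiv.prodCongr_apply, Prod.map_apply,
      Equiv.symm_swap]
    by_cases h1 : x = a ∧ y = b
    · obtain ⟨rfl, rfl⟩ := h1
      simp [hσ, hlt]
    by_cases h2 : x = b ∧ y = a
    · obtain ⟨rfl, rfl⟩ := h2
      simp [hσ.not_gt, hlt.not_gt, hlt.ne']
    rw [lt_swap_iff_of_adjacent hab h1 h2]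
    simp [h1]
  rw [invCount, key, Finset.card_insert_of_notMem, Finset.card_map, invCount]
  rw [Finset.mem_map_equiv]
  simp [he, hlt.not_gt]

theorem list_ofFn_prod_split {R : Type} [Monoid R] {t : ℕ} (g : Fin t → R) {a b : Fin t}
    (hab : (b : ℕ) = a + 1) :
    (List.ofFn g).prod = ((List.ofFn g).take a).prod * (g a * g b) *
      ((List.ofFn g).drop (a + 2)).prod := by
  rw [← List.prod_take_mul_prod_drop (List.ofFn g) a,
    List.drop_eq_getElem_cons (by simp), List.drop_eq_getElem_cons (by simp; lia)]
  have : (⟨a + 1, by lia⟩ : Fin t) = b := Fin.ext hab.symm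
  simp [mul_assoc, this]

theorem list_ofFn_take_congr {R : Type} {t : ℕ} {g h : Fin t → R} (a : ℕ)
    (hgh : ∀ x : Fin t, (x : ℕ) < a → g x = h x) :
    (List.ofFn g).take a = (List.ofFn h).take a := by
  refine List.ext_getElem (by simp) fun i h1 h2 => ?_
  simp only [List.length_take, List.length_ofFn] at h1
  simp only [List.getElem_take, List.getElem_ofFn]
  exact hgh _ (by simp only; lia)

theorem list_ofFn_drop_congr {R : Type} {t : ℕ} {g h : Fin t → R} (a : ℕ)
    (hgh : ∀ x : Fin t, a ≤ (x : ℕ) → g x = h x) :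
    (List.ofFn g).drop a = (List.ofFn h).drop a := by
  refine List.ext_getElem (by simp) fun i h1 h2 => ?_
  simp only [List.getElem_drop, List.getElem_ofFn]
  exact hgh _ (by simp only; lia)

theorem list_ofFn_sum_prod {R : Type} [Semiring R] {n : ℕ} :
    ∀ {t : ℕ} (A : Fin t → Fin n → R), (List.ofFn fun a => ∑ l, A a l).prod =
      ∑ κ : Fin t → Fin n, (List.ofFn fun a => A a (κ a)).prod
  | 0, A => by simp
  | t + 1, A => by
    rw [List.ofFn_succ, List.prod_cons, list_ofFn_sum_prod, Finset.sum_mul_sum,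
      ← Finset.sum_product', ← (Fin.consEquiv fun _ : Fin (t + 1) => Fin n).sum_comp]
    refine Finset.sum_congr (by simp) fun p _ => ?_
    simp [List.ofFn_succ, Fin.consEquiv]

theorem list_ofFn_mul_prod {R : Type} [Monoid R] :
    ∀ {t : ℕ} (x y : Fin t → R), (∀ a b, Commute (x a) (y b)) →
      (List.ofFn fun a => x a * y a).prod = (List.ofFn x).prod * (List.ofFn y).prod
  | 0, x, y, _ => by simp
  | t + 1, x, y, h => by
    have hc : Commute (y 0) (List.ofFn fun a : Fin t => x a.succ).prod := by
      refine Commute.list_prod_right _ _ fun z hz => ?_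
      obtain ⟨a, rfl⟩ := List.mem_ofFn.1 hz
      exact (h _ _).symm
    rw [List.ofFn_succ, List.prod_cons,
      list_ofFn_mul_prod (fun a => x a.succ) (fun a => y a.succ) fun a b => h _ _,
      List.ofFn_succ, List.ofFn_succ, List.prod_cons, List.prod_cons]
    exact hc.mul_mul_mul_comm _ _

variable {k : Type} [Field k] {q : k} {n : ℕ} {R : Type} [Ring R] [Algebra k R]

/-- The quantum minor expression of a matrix for arbitrary tuples of rows and columns. -/
def matrixMinor (q : k) (Z : Matrix (Fin n) (Fin n) R) {t : ℕ} (ro co : Fin t → Fin n) : R :=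
  ∑ σ : Equiv.Perm (Fin t), (-q) ^ invCount σ • (List.ofFn fun a => Z (ro a) (co (σ a))).prod

theorem matrixMinor_mul {X Y : Matrix (Fin n) (Fin n) R}
    (hXY : ∀ i j l m, Commute (X i j) (Y l m)) {t : ℕ} (ro co : Fin t → Fin n) :
    matrixMinor q (X * Y) ro co = ∑ κ : Fin t → Fin n,
      (List.ofFn fun a => X (ro a) (κ a)).prod * matrixMinor q Y κ co := by
  simp only [matrixMinor, Matrix.mul_apply, list_ofFn_sum_prod, Finset.mul_sum, Finset.smul_sum,
    mul_smul_comm]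
  rw [Finset.sum_comm]
  refine Finset.sum_congr rfl fun κ _ => Finset.sum_congr rfl fun σ _ => ?_
  rw [list_ofFn_mul_prod _ _ fun a b => hXY _ _ _ _]

/-- The two terms of the minor belonging to `σ` and to `σ` composed with a transposition. -/
def minorPair (q : k) (Z : Matrix (Fin n) (Fin n) R) {t : ℕ} (ro co : Fin t → Fin n)
    (a b : Fin t) (σ : Equiv.Perm (Fin t)) : R :=
  (-q) ^ invCount σ • (List.ofFn fun x => Z (ro x) (co (σ x))).prod +
    (-q) ^ invCount (σ * Equiv.swap a b) •
      (List.ofFn fun x => Z (ro x) (co ((σ * Equiv.swap a b) x))).prod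

theorem two_smul_matrixMinor (Z : Matrix (Fin n) (Fin n) R) {t : ℕ} (ro co : Fin t → Fin n)
    (a b : Fin t) : (2 : k) • matrixMinor q Z ro co = ∑ σ, minorPair q Z ro co a b σ := by
  simp only [minorPair, Finset.sum_add_distrib]
  rw [two_smul]
  congr 1
  exact (Equiv.sum_comp (Equiv.mulRight (Equiv.swap a b)) fun σ : Equiv.Perm (Fin t) =>
    (-q) ^ invCount σ • (List.ofFn fun x => Z (ro x) (co (σ x))).prod).symm

theorem minorPair_mul_swap (Z : Matrix (Fin n) (Fin n) R) {t : ℕ} (ro co : Fin t → Fin n)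
    (a b : Fin t) (σ : Equiv.Perm (Fin t)) :
    minorPair q Z ro co a b (σ * Equiv.swap a b) = minorPair q Z ro co a b σ := by
  simp only [minorPair, mul_assoc, Equiv.swap_mul_self, mul_one]
  rw [add_comm]

theorem minorPair_eq (Z : Matrix (Fin n) (Fin n) R) {t : ℕ} (ro co : Fin t → Fin n)
    {a b : Fin t} (hab : (b : ℕ) = a + 1) (σ : Equiv.Perm (Fin t)) (hσ : σ a < σ b) :
    minorPair q Z ro co a b σ = (-q) ^ invCount σ •
      (((List.ofFn fun x => Z (ro x) (co (σ x))).take a).prod *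
        (Z (ro a) (co (σ a)) * Z (ro b) (co (σ b)) -
          q • (Z (ro a) (co (σ b)) * Z (ro b) (co (σ a)))) *
        ((List.ofFn fun x => Z (ro x) (co (σ x))).drop (a + 2)).prod) := by
  have hfix : ∀ x : Fin t, x ≠ a → x ≠ b → (σ * Equiv.swap a b) x = σ x := fun x h1 h2 => by
    rw [Equiv.Perm.mul_apply, Equiv.swap_apply_of_ne_of_ne h1 h2]
  rw [minorPair, invCount_mul_swap σ hab hσ, list_ofFn_prod_split _ hab,
    list_ofFn_prod_split (fun x => Z (ro x) (co ((σ * Equiv.swap a b) x))) hab,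
    list_ofFn_take_congr (g := fun x => Z (ro x) (co ((σ * Equiv.swap a b) x)))
      (h := fun x => Z (ro x) (co (σ x))) a fun x hx => by
        rw [hfix x (by rintro rfl; lia) (by rintro rfl; lia)],
    list_ofFn_drop_congr (g := fun x => Z (ro x) (co ((σ * Equiv.swap a b) x)))
      (h := fun x => Z (ro x) (co (σ x))) (a + 2) fun x hx => by
        rw [hfix x (by rintro rfl; lia) (by rintro rfl; lia)]]
  simp only [Equiv.Perm.mul_apply, Equiv.swap_apply_left, Equiv.swap_apply_right]
  rw [pow_succ, mul_smul, ← smul_add, mul_sub, sub_mul, neg_smul, mul_smul_comm, smul_mul_assoc,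
    sub_eq_add_neg]

theorem minorPair_eq_zero {Z : Matrix (Fin n) (Fin n) R} (hZ : IsQuantumMatrix q Z) {t : ℕ}
    {ro co : Fin t → Fin n} (hco : StrictMono co) {a b : Fin t} (hab : (b : ℕ) = a + 1)
    (hro : ro a = ro b) (σ : Equiv.Perm (Fin t)) : minorPair q Z ro co a b σ = 0 := by
  wlog hσ : σ a < σ b generalizing σ
  · rw [← minorPair_mul_swap]
    refine this _ ?_
    have hne : σ a ≠ σ b := σ.injective.ne (by rintro rfl; lia)
    simpa using lt_of_le_of_ne (not_lt.1 hσ) hne.symm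
  rw [minorPair_eq Z ro co hab σ hσ, hro, hZ.row (ro b) _ _ (hco hσ)]
  simp

theorem minorPair_swap_rows (hq : q ≠ 0) {Z : Matrix (Fin n) (Fin n) R}
    (hZ : IsQuantumMatrix q Z) {t : ℕ}
    {ro co : Fin t → Fin n} (hco : StrictMono co) {a b : Fin t} (hab : (b : ℕ) = a + 1)
    (hro : ro a < ro b) (σ : Equiv.Perm (Fin t)) :
    minorPair q Z (ro ∘ Equiv.swap a b) co a b σ = (-q) • minorPair q Z ro co a b σ := by
  wlog hσ : σ a < σ b generalizing σ
  · rw [← minorPair_mul_swap, ← minorPair_mul_swap Z ro]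
    refine this _ ?_
    have hne : σ a ≠ σ b := σ.injective.ne (by rintro rfl; lia)
    simpa using lt_of_le_of_ne (not_lt.1 hσ) hne.symm
  have hfix : ∀ x : Fin t, x ≠ a → x ≠ b → (ro ∘ Equiv.swap a b) x = ro x := fun x h1 h2 => by
    rw [Function.comp_apply, Equiv.swap_apply_of_ne_of_ne h1 h2]
  rw [minorPair_eq Z _ co hab σ hσ, minorPair_eq Z _ co hab σ hσ,
    list_ofFn_take_congr (g := fun x => Z ((ro ∘ Equiv.swap a b) x) (co (σ x)))
      (h := fun x => Z (ro x) (co (σ x))) a fun x hx => by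
        rw [hfix x (by rintro rfl; lia) (by rintro rfl; lia)],
    list_ofFn_drop_congr (g := fun x => Z ((ro ∘ Equiv.swap a b) x) (co (σ x)))
      (h := fun x => Z (ro x) (co (σ x))) (a + 2) fun x hx => by
        rw [hfix x (by rintro rfl; lia) (by rintro rfl; lia)]]
  have h := hco hσ
  have key : Z (ro b) (co (σ a)) * Z (ro a) (co (σ b)) -
        q • (Z (ro b) (co (σ b)) * Z (ro a) (co (σ a))) =
      (-q) • (Z (ro a) (co (σ a)) * Z (ro b) (co (σ b)) -
        q • (Z (ro a) (co (σ b)) * Z (ro b) (co (σ a)))) := by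
    rw [hZ.diag _ _ _ _ hro h, ← hZ.cross _ _ _ _ hro h, smul_sub, smul_add, smul_smul, smul_smul]
    have : -q * (q - q⁻¹) = 1 - q * q := by field_simp; ring
    rw [this]
    module
  simp only [Function.comp_apply, Equiv.swap_apply_left, Equiv.swap_apply_right]
  rw [key, smul_comm (-q), mul_smul_comm, smul_mul_assoc]

theorem matrixMinor_eq_zero_of_adjacent [CharZero k] {Z : Matrix (Fin n) (Fin n) R}
    (hZ : IsQuantumMatrix q Z) {t : ℕ} {ro co : Fin t → Fin n} (hco : StrictMono co)
    {a b : Fin t} (hab : (b : ℕ) = a + 1) (hro : ro a = ro b) : matrixMinor q Z ro co = 0 := by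
  have h := two_smul_matrixMinor (q := q) Z ro co a b
  rw [Finset.sum_eq_zero fun σ _ => minorPair_eq_zero hZ hco hab hro σ] at h
  exact (smul_eq_zero_iff_right two_ne_zero).1 h

theorem matrixMinor_swap_rows [CharZero k] (hq : q ≠ 0) {Z : Matrix (Fin n) (Fin n) R}
    (hZ : IsQuantumMatrix q Z) {t : ℕ} {ro co : Fin t → Fin n} (hco : StrictMono co)
    {a b : Fin t} (hab : (b : ℕ) = a + 1) (hro : ro a < ro b) :
    matrixMinor q Z (ro ∘ Equiv.swap a b) co = (-q) • matrixMinor q Z ro co := by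
  have h := two_smul_matrixMinor (q := q) Z (ro ∘ Equiv.swap a b) co a b
  rw [Finset.sum_congr rfl fun σ _ => minorPair_swap_rows hq hZ hco hab hro σ,
    ← Finset.smul_sum, ← two_smul_matrixMinor, smul_comm] at h
  exact (smul_right_injective R (two_ne_zero (α := k))) h

theorem matrixMinor_eq_zero_of_swap [CharZero k] (hq : q ≠ 0) {Z : Matrix (Fin n) (Fin n) R}
    (hZ : IsQuantumMatrix q Z) {t : ℕ} {ro co : Fin t → Fin n} (hco : StrictMono co)
    {a b : Fin t} (hab : (b : ℕ) = a + 1)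
    (h : matrixMinor q Z (ro ∘ Equiv.swap a b) co = 0) : matrixMinor q Z ro co = 0 := by
  rcases lt_trichotomy (ro a) (ro b) with hlt | heq | hgt
  · rw [matrixMinor_swap_rows hq hZ hco hab hlt] at h
    exact (smul_eq_zero_iff_right (neg_ne_zero.2 hq)).1 h
  · exact matrixMinor_eq_zero_of_adjacent hZ hco hab heq
  · have h' := matrixMinor_swap_rows hq hZ (ro := ro ∘ Equiv.swap a b) hco hab (by simpa using hgt)
    have hcomp : (ro ∘ Equiv.swap a b) ∘ Equiv.swap a b = ro := by
      ext x
      simp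
    rwa [hcomp, h, smul_zero] at h'

theorem matrixMinor_eq_zero_of_repeated [CharZero k] (hq : q ≠ 0)
    {Z : Matrix (Fin n) (Fin n) R} (hZ : IsQuantumMatrix q Z) {t : ℕ} {co : Fin t → Fin n}
    (hco : StrictMono co) : ∀ (d : ℕ) (ro : Fin t → Fin n) (a b : Fin t),
      (b : ℕ) = a + d + 1 → ro a = ro b → matrixMinor q Z ro co = 0
  | 0, ro, a, b, hab, hro => matrixMinor_eq_zero_of_adjacent hZ hco hab hro
  | d + 1, ro, a, b, hab, hro => by
    let c : Fin t := ⟨a + d + 1, by lia⟩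
    have hcb : (b : ℕ) = c + 1 := hab
    refine matrixMinor_eq_zero_of_swap hq hZ hco hcb ?_
    refine matrixMinor_eq_zero_of_repeated hq hZ hco d _ a c rfl ?_
    have hac : a ≠ c := by simp only [c, ne_eq, Fin.ext_iff]; lia
    have hb : a ≠ b := by simp only [ne_eq, Fin.ext_iff]; lia
    simp [Equiv.swap_apply_of_ne_of_ne hac hb, hro]

/-- Minors of size larger than the number of nonzero rows vanish. -/
theorem matrixMinor_eq_zero_of_rows [CharZero k] (hq : q ≠ 0)
    {Z : Matrix (Fin n) (Fin n) R} (hZ : IsQuantumMatrix q Z) {r : ℕ}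
    (hr : ∀ i j : Fin n, r ≤ (i : ℕ) → Z i j = 0) {co : Fin (r + 1) → Fin n}
    (hco : StrictMono co) (ro : Fin (r + 1) → Fin n) : matrixMinor q Z ro co = 0 := by
  by_cases h : ∃ a, r ≤ (ro a : ℕ)
  · obtain ⟨a, ha⟩ := h
    refine Finset.sum_eq_zero fun σ _ => ?_
    rw [List.prod_eq_zero, smul_zero]
    exact List.mem_ofFn.2 ⟨a, hr _ _ ha⟩
  · push Not at h
    obtain ⟨a, b, hne, hab⟩ := Fintype.exists_ne_map_eq_of_card_lt
      (fun a => (⟨ro a, h a⟩ : Fin r)) (by simp)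
    have hab' : ro a = ro b := Fin.ext (by simpa using hab)
    rcases lt_or_gt_of_ne hne with hlt | hlt
    · exact matrixMinor_eq_zero_of_repeated hq hZ hco (b - a - 1) ro a b
        (by rw [Fin.lt_def] at hlt; lia) hab'
    · exact matrixMinor_eq_zero_of_repeated hq hZ hco (a - b - 1) ro b a
        (by rw [Fin.lt_def] at hlt; lia) hab'.symm

end Minors

section PathMatrices

/-- The exponent of a single variable, of weight `2 |a - b|`. -/
noncomputable def varExp (p : ℤ × ℤ) : QExp := (Pi.single p 1, 2 * |p.1 - p.2|)

/-- The exponent of the hook joining `(i, j)` to the diagonal. -/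
def hookExp (i j : ℤ) : QExp :=
  (fun p => if (p.2 = j ∧ j ≤ p.1 ∧ p.1 ≤ i) ∨ (p.1 = i ∧ i ≤ p.2 ∧ p.2 ≤ j) then 1 else 0,
    (i - j) ^ 2 + |i - j|)

/-- The exponent of the variable `p`, as an additive map. -/
def evalExp (p : ℤ × ℤ) : QExp →+ ℤ :=
  (Pi.evalAddMonoidHom (fun _ => ℤ) p).comp (AddMonoidHom.fst _ _)

theorem evalExp_apply (p : ℤ × ℤ) (v : QExp) : evalExp p v = v.1 p := rfl

theorem evalExp_varExp (p p' : ℤ × ℤ) : evalExp p (varExp p') = if p = p' then 1 else 0 := by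
  simp [evalExp_apply, varExp, Pi.single_apply]

theorem hookExp_self (i : ℤ) : hookExp i i = varExp (i, i) := by
  refine Prod.ext (funext fun p => ?_) (by simp [hookExp, varExp])
  simp only [hookExp, varExp, Pi.single_apply, Prod.ext_iff]
  split_ifs <;> lia

theorem hookExp_of_lt {i j : ℤ} (h : j < i) : hookExp i j = varExp (i, j) + hookExp (i - 1) j := by
  refine Prod.ext (funext fun p => ?_) ?_
  · simp only [hookExp, varExp, Prod.fst_add, Pi.add_apply, Pi.single_apply, Prod.ext_iff]
    split_ifs <;> lia
  · simp only [hookExp, varExp, Prod.snd_add]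
    rw [abs_of_nonneg (by lia : 0 ≤ i - j), abs_of_nonneg (by lia : 0 ≤ i - 1 - j)]
    ring

theorem hookExp_of_gt {i j : ℤ} (h : i < j) : hookExp i j = hookExp i (j - 1) + varExp (i, j) := by
  refine Prod.ext (funext fun p => ?_) ?_
  · simp only [hookExp, varExp, Prod.fst_add, Pi.add_apply, Pi.single_apply, Prod.ext_iff]
    split_ifs <;> lia
  · simp only [hookExp, varExp, Prod.snd_add]
    rw [abs_of_nonpos (by lia : i - j ≤ 0), abs_of_nonpos (by lia : i - (j - 1) ≤ 0)]
    ring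

variable {k : Type} [Field k]

/-- A lower bidiagonal quantum matrix whose subdiagonal entries are the variables `y i`. -/
noncomputable def bidiagonal (q : k) (n : ℕ) (y : ℤ → ℤ × ℤ) :
    Matrix (Fin n) (Fin n) (Module.End k (QExp →₀ k)) := fun i j =>
  if i = j then monOp q 0 (evalExp (y ((i : ℕ) + 1)) - evalExp (y (i : ℕ)))
  else if (i : ℕ) = j + 1 then monOp q (varExp (y (i : ℕ))) 0 else 0

/-- The diagonal quantum matrix of rank `r`. -/
noncomputable def diagonalRank (q : k) (n r : ℕ) :
    Matrix (Fin n) (Fin n) (Module.End k (QExp →₀ k)) := fun i j =>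
  if i = j ∧ (i : ℕ) < r then monOp q (varExp ((i : ℕ), (i : ℕ))) 0 else 0

theorem bidiagonal_self (q : k) {n : ℕ} (y : ℤ → ℤ × ℤ) (i : Fin n) :
    bidiagonal q n y i i = monOp q 0 (evalExp (y ((i : ℕ) + 1)) - evalExp (y (i : ℕ))) :=
  if_pos rfl

theorem bidiagonal_sub (q : k) {n : ℕ} (y : ℤ → ℤ × ℤ) {i j : Fin n} (h : (i : ℕ) = j + 1) :
    bidiagonal q n y i j = monOp q (varExp (y (i : ℕ))) 0 := by
  rw [bidiagonal, if_neg (by rintro rfl; lia), if_pos h]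

theorem bidiagonal_eq_zero (q : k) {n : ℕ} (y : ℤ → ℤ × ℤ) {i j : Fin n} (h : i ≠ j)
    (h' : (i : ℕ) ≠ j + 1) : bidiagonal q n y i j = 0 := by
  rw [bidiagonal, if_neg h, if_neg h']

variable {q : k} {n : ℕ}

theorem bidiagonal_commute (hq : q ≠ 0) {y y' : ℤ → ℤ × ℤ} (h : ∀ a b, y a ≠ y' b) (i j l m : Fin n) :
    Commute (bidiagonal q n y i j) (bidiagonal q n y' l m) := by
  have h' : ∀ a b, y' b ≠ y a := fun a b => (h a b).symm
  unfold bidiagonal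
  split_ifs <;> first
    | exact Commute.zero_left _
    | exact Commute.zero_right _
    | exact monOp_commute hq (by simp [evalExp_varExp, h, h'])

theorem bidiagonal_commute_diagonalRank (hq : q ≠ 0) {y : ℤ → ℤ × ℤ} (h : ∀ a, (y a).1 ≠ (y a).2) (r : ℕ)
    (i j l m : Fin n) : Commute (bidiagonal q n y i j) (diagonalRank q n r l m) := by
  have h' : ∀ a b, y a ≠ (b, b) := fun a b hab => h a (by rw [hab])
  unfold bidiagonal diagonalRank
  split_ifs <;> first
    | exact Commute.zero_left _
    | exact Commute.zero_right _
    | exact monOp_commute hq (by simp [evalExp_varExp, h'])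

theorem diagonalRank_isQuantumMatrix (hq : q ≠ 0) (r : ℕ) : IsQuantumMatrix q (diagonalRank q n r) := by
  constructor
  · intro i j l hjl
    unfold diagonalRank
    split_ifs <;> first | simp | lia
  · intro i s j his
    unfold diagonalRank
    split_ifs <;> first | simp | lia
  · intro i s j l his hlj
    unfold diagonalRank
    split_ifs <;> first | simp | lia
  · intro i s j l his hjl
    have h0 : diagonalRank q n r i l * diagonalRank q n r s j = 0 := by
      unfold diagonalRank
      split_ifs <;> first | simp | lia
    rw [h0, smul_zero, add_zero]
    unfold diagonalRank
    split_ifs <;> first | simp | exact monOp_commute hq (by simp)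

theorem bidiagonal_isQuantumMatrix (hq : q ≠ 0) {y : ℤ → ℤ × ℤ} (hy : Function.Injective y) :
    IsQuantumMatrix q (bidiagonal q n y) := by
  constructor
  · intro i j l hjl
    by_cases h : i = l ∧ (i : ℕ) = j + 1
    · obtain ⟨rfl, h⟩ := h
      rw [bidiagonal_sub q y h, bidiagonal_self, monOp_mul_monOp hq]
      simp [evalExp_varExp, hy.eq_iff]
    · unfold bidiagonal
      split_ifs <;> first | simp | lia
  · intro i s j his
    by_cases h : i = j ∧ (s : ℕ) = i + 1
    · obtain ⟨rfl, h⟩ := h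
      rw [bidiagonal_sub q y h, bidiagonal_self, monOp_mul_monOp hq]
      simp [evalExp_varExp, hy.eq_iff, h]
    · unfold bidiagonal
      split_ifs <;> first | simp | lia
  · intro i s j l his hlj
    unfold bidiagonal
    split_ifs <;> first | simp | lia
  · intro i s j l his hjl
    have h0 : bidiagonal q n y i l * bidiagonal q n y s j = 0 := by
      unfold bidiagonal
      split_ifs <;> first | simp | lia
    rw [h0, smul_zero, add_zero]
    unfold bidiagonal
    split_ifs <;> first
      | simp
      | exact monOp_commute hq (by simp [evalExp_varExp, hy.eq_iff]; try (split_ifs <;> omega))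

theorem bidiagonal_self_hasLowest (hq : q ≠ 0) (y : ℤ → ℤ × ℤ) (i : Fin n) :
    HasLowest (bidiagonal q n y i i) 0 := by
  rw [bidiagonal_self]
  exact HasLowest.monOp hq _ _

theorem bidiagonal_sub_hasLowest (hq : q ≠ 0) (y : ℤ → ℤ × ℤ) {i j : Fin n} (h : (i : ℕ) = j + 1) :
    HasLowest (bidiagonal q n y i j) (varExp (y (i : ℕ))) := by
  rw [bidiagonal_sub q y h]
  exact HasLowest.monOp hq _ _

end PathMatrices

section PathProducts

variable {k : Type} [Field k]

/-- The product of the diagonal matrix of rank `r` with `s` upper bidiagonal matrices. -/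
noncomputable def upperPath (q : k) (n r : ℕ) :
    ℕ → Matrix (Fin n) (Fin n) (Module.End k (QExp →₀ k))
  | 0 => diagonalRank q n r
  | s + 1 => upperPath q n r s * (bidiagonal q n fun i => (i - ((s : ℤ) + 1), i)).transpose

/-- The product of `s` lower bidiagonal matrices with `upperPath q n r n`. -/
noncomputable def fullPath (q : k) (n r : ℕ) :
    ℕ → Matrix (Fin n) (Fin n) (Module.End k (QExp →₀ k))
  | 0 => upperPath q n r n
  | s + 1 => bidiagonal q n (fun i => (i, i - ((s : ℤ) + 1))) * fullPath q n r s

variable {q : k} {n r : ℕ}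

theorem bidiagonal_commute_upperPath (hq : q ≠ 0) {y : ℤ → ℤ × ℤ} {s : ℕ}
    (h : ∀ a, (y a).2 < (y a).1 ∨ (y a).1 + s < (y a).2) (i j l m : Fin n) :
    Commute (bidiagonal q n y i j) (upperPath q n r s l m) := by
  induction s generalizing l m with
  | zero =>
    refine bidiagonal_commute_diagonalRank hq (fun a => ?_) r i j l m
    rcases h a with h | h <;> lia
  | succ s ih =>
    refine commute_matrix_mul (R := Module.End k (QExp →₀ k)) (ih fun a => ?_) (fun l m => ?_) l m
    · have := h a
      lia
    · rw [Matrix.transpose_apply]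
      refine bidiagonal_commute hq (fun a b hab => ?_) i j m l
      have := h a
      rw [hab] at this
      push_cast at this
      lia

theorem bidiagonal_commute_fullPath (hq : q ≠ 0) {y : ℤ → ℤ × ℤ} {s : ℕ}
    (h : ∀ a, (y a).2 + s < (y a).1) (i j l m : Fin n) :
    Commute (bidiagonal q n y i j) (fullPath q n r s l m) := by
  induction s generalizing l m with
  | zero => exact bidiagonal_commute_upperPath hq (fun a => Or.inl (by simpa using h a)) i j l m
  | succ s ih =>
    refine commute_matrix_mul (R := Module.End k (QExp →₀ k)) (fun l m => ?_) (ih fun a => ?_) l m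
    · refine bidiagonal_commute hq (fun a b hab => ?_) i j l m
      have := h a
      rw [hab] at this
      push_cast at this
      lia
    · have := h a
      lia

theorem upperPath_isQuantumMatrix (hq : q ≠ 0) (s : ℕ) :
    IsQuantumMatrix q (upperPath q n r s) := by
  induction s with
  | zero => exact diagonalRank_isQuantumMatrix hq r
  | succ s ih =>
    refine ih.mul hq (bidiagonal_isQuantumMatrix hq fun a b h => (Prod.ext_iff.1 h).2).transpose
      fun i j l m => ?_
    rw [Matrix.transpose_apply]
    exact (bidiagonal_commute_upperPath hq (fun a => Or.inr (by simp only; lia)) m l i j).symm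

theorem fullPath_isQuantumMatrix (hq : q ≠ 0) (s : ℕ) :
    IsQuantumMatrix q (fullPath q n r s) := by
  induction s with
  | zero => exact upperPath_isQuantumMatrix hq n
  | succ s ih =>
    refine (bidiagonal_isQuantumMatrix hq fun a b h => (Prod.ext_iff.1 h).1).mul hq ih
      fun i j l m => bidiagonal_commute_fullPath hq (fun a => ?_) i j l m
    simp only
    lia

theorem upperPath_row_eq_zero (s : ℕ) (i j : Fin n) (hi : r ≤ (i : ℕ)) :
    upperPath q n r s i j = 0 := by
  induction s generalizing j with
  | zero => exact if_neg fun h => by lia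
  | succ s ih =>
    rw [upperPath, Matrix.mul_apply]
    exact Finset.sum_eq_zero fun l _ => by rw [ih, zero_mul]

theorem upperPath_eq_zero (s : ℕ) (i j : Fin n) (h : (j : ℕ) < i ∨ (i : ℕ) + s < j) :
    upperPath q n r s i j = 0 := by
  induction s generalizing j with
  | zero => exact if_neg fun h => by lia
  | succ s ih =>
    rw [upperPath, Matrix.mul_apply]
    refine Finset.sum_eq_zero fun l _ => ?_
    by_cases h1 : j = l
    · rw [ih l (by subst h1; lia), zero_mul]
    by_cases h2 : (j : ℕ) = l + 1
    · rw [ih l (by lia), zero_mul]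
    rw [Matrix.transpose_apply, bidiagonal_eq_zero q _ h1 h2, mul_zero]

theorem fullPath_eq_zero (s : ℕ) (i j : Fin n) (h : (j : ℕ) + s < i) :
    fullPath q n r s i j = 0 := by
  induction s generalizing i with
  | zero => exact upperPath_eq_zero n i j (Or.inl (by lia))
  | succ s ih =>
    rw [fullPath, Matrix.mul_apply]
    refine Finset.sum_eq_zero fun l _ => ?_
    by_cases h1 : i = l
    · rw [ih l (by subst h1; lia), mul_zero]
    by_cases h2 : (i : ℕ) = l + 1
    · rw [ih l (by lia), mul_zero]
    rw [bidiagonal_eq_zero q _ h1 h2, zero_mul]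

theorem upperPath_hasLowest (hq : q ≠ 0) (s : ℕ) (i j : Fin n) (hi : (i : ℕ) < r)
    (hij : (i : ℕ) ≤ j) (hj : (j : ℕ) ≤ i + s) :
    HasLowest (upperPath q n r s i j) (hookExp (i : ℕ) (j : ℕ)) := by
  induction s generalizing j with
  | zero =>
    obtain rfl : i = j := Fin.ext (by lia)
    rw [upperPath, diagonalRank, if_pos ⟨rfl, hi⟩, hookExp_self]
    exact HasLowest.monOp hq _ _
  | succ s ih =>
    rw [upperPath, Matrix.mul_apply]
    by_cases hjs : (j : ℕ) ≤ i + s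
    · refine HasLowest.sum j ?_ fun l hl => ?_
      · have := (ih j hij hjs).mul (bidiagonal_self_hasLowest hq
          (fun i => (i - ((s : ℤ) + 1), i)) j)
        rwa [add_zero] at this
      · by_cases h2 : (j : ℕ) = l + 1
        · by_cases hil : (i : ℕ) ≤ l
          · have := (ih l hil (by lia)).mul (bidiagonal_sub_hasLowest hq
              (fun i => (i - ((s : ℤ) + 1), i)) h2)
            refine this.raisesBy.mono ?_
            simp only [hookExp, varExp, Prod.snd_add]
            rw [abs_of_nonpos (by lia), abs_of_nonpos (by lia), abs_of_nonpos (by lia), h2]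
            push_cast
            nlinarith
          · rw [upperPath_eq_zero s i l (Or.inl (by lia)), zero_mul]
            exact RaisesBy.zero _
        · rw [Matrix.transpose_apply, bidiagonal_eq_zero q _ (Ne.symm hl) h2, mul_zero]
          exact RaisesBy.zero _
    · have hj' : (j : ℕ) = i + s + 1 := by lia
      let l₀ : Fin n := ⟨i + s, by lia⟩
      refine HasLowest.sum l₀ ?_ fun l hl => ?_
      · have := (ih l₀ (by simp [l₀]) le_rfl).mul (bidiagonal_sub_hasLowest hq
          (fun i => (i - ((s : ℤ) + 1), i)) (i := j) (j := l₀) hj')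
        rw [hookExp_of_gt (by lia), Matrix.transpose_apply]
        convert this using 4 <;> simp only [hj', l₀] <;> push_cast <;> ring
      · by_cases h1 : j = l
        · rw [← h1, upperPath_eq_zero s i j (Or.inr (by lia)), zero_mul]
          exact RaisesBy.zero _
        · have h2 : (j : ℕ) ≠ l + 1 := fun h2 => hl (Fin.ext (by simp only [l₀]; lia))
          rw [Matrix.transpose_apply, bidiagonal_eq_zero q _ h1 h2, mul_zero]
          exact RaisesBy.zero _

theorem fullPath_raisesBy (hq : q ≠ 0) (s : ℕ) (i j : Fin n) :
    RaisesBy (fullPath q n r s i j) (hookExp (i : ℕ) (j : ℕ)).2 := by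
  induction s generalizing i with
  | zero =>
    rw [fullPath]
    by_cases hi : r ≤ (i : ℕ)
    · rw [upperPath_row_eq_zero n i j hi]
      exact RaisesBy.zero _
    by_cases hij : (j : ℕ) < i
    · rw [upperPath_eq_zero n i j (Or.inl hij)]
      exact RaisesBy.zero _
    exact (upperPath_hasLowest hq n i j (by lia) (by lia) (by lia)).raisesBy
  | succ s ih =>
    by_cases hs : (j : ℕ) + (s + 1) < i
    · rw [fullPath_eq_zero (s + 1) i j hs]
      exact RaisesBy.zero _
    rw [fullPath, Matrix.mul_apply]
    refine RaisesBy.sum _ fun l _ => ?_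
    by_cases h1 : i = l
    · subst h1
      have := (bidiagonal_self_hasLowest hq (fun i => (i, i - ((s : ℤ) + 1))) i).raisesBy.mul (ih i)
      simpa using this
    by_cases h2 : (i : ℕ) = l + 1
    · refine ((bidiagonal_sub_hasLowest hq
        (fun i => (i, i - ((s : ℤ) + 1))) h2).raisesBy.mul (ih l)).mono ?_
      simp only [hookExp, varExp, h2]
      push_cast
      rw [abs_of_nonneg (by lia : (0 : ℤ) ≤ l + 1 - (l + 1 - (s + 1)))]
      by_cases hlj : (j : ℤ) ≤ (l : ℕ)
      · rw [abs_of_nonneg (by lia), abs_of_nonneg (by lia)]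
        have : (l : ℤ) ≤ j + s := by omega
        nlinarith
      · rw [abs_of_nonpos (by lia), abs_of_nonpos (by lia)]
        nlinarith
    rw [bidiagonal_eq_zero q _ h1 h2, zero_mul]
    exact RaisesBy.zero _

theorem fullPath_hasLowest (hq : q ≠ 0) (s : ℕ) (i j : Fin n) (hr : (i : ℕ) < r ∨ (j : ℕ) < r)
    (hi : (i : ℕ) ≤ j + s) :
    HasLowest (fullPath q n r s i j) (hookExp (i : ℕ) (j : ℕ)) := by
  induction s generalizing i with
  | zero => exact upperPath_hasLowest hq n i j (by lia) (by lia) (by lia)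
  | succ s ih =>
    rw [fullPath, Matrix.mul_apply]
    by_cases his : (i : ℕ) ≤ j + s
    · refine HasLowest.sum i ?_ fun l hl => ?_
      · have := (bidiagonal_self_hasLowest hq
          (fun i => (i, i - ((s : ℤ) + 1))) i).mul (ih i hr his)
        rwa [zero_add] at this
      · by_cases h2 : (i : ℕ) = l + 1
        · refine ((bidiagonal_sub_hasLowest hq
            (fun i => (i, i - ((s : ℤ) + 1))) h2).raisesBy.mul
            (fullPath_raisesBy hq s l j)).mono ?_
          simp only [hookExp, varExp, h2]
          push_cast
          rw [abs_of_nonneg (by lia : (0 : ℤ) ≤ l + 1 - (l + 1 - (s + 1)))]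
          by_cases hlj : (j : ℤ) ≤ (l : ℕ)
          · rw [abs_of_nonneg (by lia), abs_of_nonneg (by lia)]
            have : (l : ℤ) + 1 ≤ j + s := by lia
            nlinarith
          · rw [abs_of_nonpos (by lia), abs_of_nonpos (by lia)]
            nlinarith
        · rw [bidiagonal_eq_zero q _ (Ne.symm hl) h2, zero_mul]
          exact RaisesBy.zero _
    · have hi' : (i : ℕ) = j + s + 1 := by lia
      let l₀ : Fin n := ⟨j + s, by lia⟩
      refine HasLowest.sum l₀ ?_ fun l hl => ?_
      · have := (bidiagonal_sub_hasLowest hq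
          (fun i => (i, i - ((s : ℤ) + 1))) (i := i) (j := l₀) hi').mul
          (ih l₀ (Or.inr (by lia)) le_rfl)
        rw [hookExp_of_lt (by lia)]
        convert this using 4 <;> simp only [hi', l₀] <;> push_cast <;> ring
      · by_cases h1 : i = l
        · rw [← h1, fullPath_eq_zero s i j (by lia), mul_zero]
          exact RaisesBy.zero _
        · have h2 : (i : ℕ) ≠ l + 1 := fun h2 => hl (Fin.ext (by simp only [l₀]; lia))
          rw [bidiagonal_eq_zero q _ h1 h2, zero_mul]
          exact RaisesBy.zero _

theorem fullPath_matrixMinor [CharZero k] (hq : q ≠ 0) (s : ℕ) {co : Fin (r + 1) → Fin n}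
    (hco : StrictMono co) (ro : Fin (r + 1) → Fin n) :
    matrixMinor q (fullPath q n r s) ro co = 0 := by
  induction s generalizing ro with
  | zero =>
    exact matrixMinor_eq_zero_of_rows hq (upperPath_isQuantumMatrix hq n)
      (fun i j => upperPath_row_eq_zero n i j) hco ro
  | succ s ih =>
    rw [fullPath, matrixMinor_mul fun i j l m =>
      bidiagonal_commute_fullPath hq (fun a => by simp only; lia) i j l m]
    exact Finset.sum_eq_zero fun κ _ => by rw [ih, mul_zero]

end PathProducts

section Straightening

/-- The indices of the generators of `A_{n,r}`. -/
abbrev AIndex (n r : ℕ) : Type := {p : Fin n × Fin n // (p.1 : ℕ) < r ∨ (p.2 : ℕ) < r}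

/-- The exponent of the hook of an index of a generator of `A_{n,r}`. -/
def AIndex.hook {n r : ℕ} (p : AIndex n r) : QExp := hookExp (p.1.1 : ℕ) (p.1.2 : ℕ)

/-- The additive functional reading off the multiplicity of the hook of `(a, b)`. -/
def hookCoord (a b : ℤ) : QExp →+ ℤ :=
  evalExp (a, b) - (if b ≤ a then evalExp (a + 1, b) else 0) -
    (if a ≤ b then evalExp (a, b + 1) else 0)

theorem hookCoord_hookExp (a b i j : ℤ) :
    hookCoord a b (hookExp i j) = if i = a ∧ j = b then 1 else 0 := by
  have h0 : ∀ v : QExp, hookCoord a b v = v.1 (a, b) - (if b ≤ a then v.1 (a + 1, b) else 0) -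
      (if a ≤ b then v.1 (a, b + 1) else 0) := by
    intro v
    unfold hookCoord
    split_ifs <;> simp [evalExp_apply]
  rw [h0]
  simp only [hookExp]
  split_ifs <;> lia

theorem hookCoord_sum_eq_count {n r : ℕ} (p : AIndex n r) (m : Multiset (AIndex n r)) :
    hookCoord (p.1.1 : ℕ) (p.1.2 : ℕ) (m.map AIndex.hook).sum = m.count p := by
  induction m using Multiset.induction_on with
  | empty => simp
  | cons x m ih =>
    rw [Multiset.map_cons, Multiset.sum_cons, map_add, ih, AIndex.hook, hookCoord_hookExp,
      Multiset.count_cons, Nat.cast_add, add_comm]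
    congr 1
    simp only [Subtype.ext_iff, Prod.ext_iff, Fin.ext_iff, Nat.cast_ite, Nat.cast_one,
      Nat.cast_zero, Nat.cast_inj]
    exact if_congr ⟨fun h => ⟨h.1.symm, h.2.symm⟩, fun h => ⟨h.1.symm, h.2.symm⟩⟩ rfl rfl

theorem hook_sum_injective (n r : ℕ) :
    Function.Injective fun m : Multiset (AIndex n r) => (m.map AIndex.hook).sum := by
  intro m m' h
  ext p
  have := congrArg (hookCoord (p.1.1 : ℕ) (p.1.2 : ℕ)) h
  simpa only [hookCoord_sum_eq_count, Nat.cast_inj] using this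

/-- The weight of a word in the generators of `A_{n,r}`. -/
def wordWeight {n r : ℕ} (l : List (AIndex n r)) : ℕ :=
  (l.map fun p => (p.1.1 : ℕ) * (p.1.2 : ℕ)).sum

theorem wordWeight_append {n r : ℕ} (l l' : List (AIndex n r)) :
    wordWeight (l ++ l') = wordWeight l + wordWeight l' := by
  simp [wordWeight]

theorem wordWeight_perm {n r : ℕ} {l l' : List (AIndex n r)} (h : l.Perm l') :
    wordWeight l = wordWeight l' :=
  (h.map _).sum_eq

variable {k : Type} [Field k] {q : k} {n r : ℕ} {R : Type} [Ring R] [Algebra k R]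

/-- The product of the entries of `Z` along a word. -/
def wordProd (Z : Matrix (Fin n) (Fin n) R) (l : List (AIndex n r)) : R :=
  (l.map fun p => Z p.1.1 p.1.2).prod

theorem wordProd_append (Z : Matrix (Fin n) (Fin n) R) (l l' : List (AIndex n r)) :
    wordProd Z (l ++ l') = wordProd Z l * wordProd Z l' := by
  simp [wordProd]

/-- The span of the words of weight less than `w`. -/
def lowerSpan (k : Type) [Field k] {n : ℕ} (r : ℕ) {R : Type} [Ring R] [Algebra k R]
    (Z : Matrix (Fin n) (Fin n) R) (w : ℕ) : Submodule k R :=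
  Submodule.span k {x | ∃ l : List (AIndex n r), wordWeight l < w ∧ x = wordProd Z l}

theorem mul_mem_lowerSpan (Z : Matrix (Fin n) (Fin n) R) (l l' : List (AIndex n r)) {w : ℕ}
    {x : R} (hx : x ∈ lowerSpan k r Z w) :
    wordProd Z l * x * wordProd Z l' ∈
      lowerSpan k r Z (wordWeight l + w + wordWeight l') := by
  induction hx using Submodule.span_induction with
  | mem x hx =>
    obtain ⟨m, hm, rfl⟩ := hx
    rw [← wordProd_append, ← wordProd_append]
    exact Submodule.subset_span ⟨_, by simp only [wordWeight_append]; lia, rfl⟩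
  | zero => simp
  | add x y _ _ hx hy =>
    rw [mul_add, add_mul]
    exact Submodule.add_mem _ hx hy
  | smul c x _ hx =>
    rw [mul_smul_comm, smul_mul_assoc]
    exact Submodule.smul_mem _ c hx

theorem wordProd_swap (hq : q ≠ 0) {Z : Matrix (Fin n) (Fin n) R} (hZ : IsQuantumMatrix q Z)
    (x y : AIndex n r) : ∃ c : k, wordProd Z [x, y] - c • wordProd Z [y, x] ∈
      lowerSpan k r Z (wordWeight [x, y]) := by
  obtain ⟨⟨i, j⟩, hx⟩ := x
  obtain ⟨⟨s, t⟩, hy⟩ := y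
  simp only at hx hy
  have of_eq : ∀ c : k, Z i j * Z s t = c • (Z s t * Z i j) →
      ∃ c : k, wordProd Z [(⟨(i, j), hx⟩ : AIndex n r), ⟨(s, t), hy⟩] -
        c • wordProd Z [(⟨(s, t), hy⟩ : AIndex n r), ⟨(i, j), hx⟩] ∈
      lowerSpan k r Z (wordWeight [(⟨(i, j), hx⟩ : AIndex n r), ⟨(s, t), hy⟩]) := by
    intro c hc
    refine ⟨c, ?_⟩
    simp [wordProd, hc]
  have of_diag : ∀ c : k, Z i j * Z s t = Z s t * Z i j + c • (Z i t * Z s j) →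
      (i < s ∧ j < t ∨ s < i ∧ t < j) →
      ∃ c : k, wordProd Z [(⟨(i, j), hx⟩ : AIndex n r), ⟨(s, t), hy⟩] -
        c • wordProd Z [(⟨(s, t), hy⟩ : AIndex n r), ⟨(i, j), hx⟩] ∈
      lowerSpan k r Z (wordWeight [(⟨(i, j), hx⟩ : AIndex n r), ⟨(s, t), hy⟩]) := by
    intro c hc h
    refine ⟨1, ?_⟩
    have h1 : (i : ℕ) < r ∨ (t : ℕ) < r := by lia
    have h2 : (s : ℕ) < r ∨ (j : ℕ) < r := by lia
    have h3 : wordProd Z [(⟨(i, j), hx⟩ : AIndex n r), ⟨(s, t), hy⟩] -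
        (1 : k) • wordProd Z [(⟨(s, t), hy⟩ : AIndex n r), ⟨(i, j), hx⟩] =
        c • wordProd Z [(⟨(i, t), h1⟩ : AIndex n r), ⟨(s, j), h2⟩] := by
      simp [wordProd, hc]
    rw [h3]
    refine Submodule.smul_mem _ _ (Submodule.subset_span ⟨_, ?_, rfl⟩)
    simp only [wordWeight, List.map_cons, List.map_nil, List.sum_cons, List.sum_nil]
    simp only [Fin.lt_def] at h
    rcases h with ⟨h, h'⟩ | ⟨h, h'⟩ <;> nlinarith
  have inv : ∀ {u v : R}, u = q • v → v = q⁻¹ • u := fun {u v} h => by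
    rw [h, smul_smul, inv_mul_cancel₀ hq, one_smul]
  rcases lt_trichotomy i s with his | rfl | his <;> rcases lt_trichotomy j t with hjt | rfl | hjt
  · exact of_diag _ (hZ.diag i s j t his hjt) (Or.inl ⟨his, hjt⟩)
  · exact of_eq _ (hZ.col i s j his)
  · exact of_eq 1 (by rw [hZ.cross i s j t his hjt, one_smul])
  · exact of_eq _ (hZ.row i j t hjt)
  · exact of_eq 1 (one_smul _ _).symm
  · exact of_eq _ (inv (hZ.row i t j hjt))
  · exact of_eq 1 (by rw [hZ.cross s i t j his hjt, one_smul])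
  · exact of_eq _ (inv (hZ.col s i j his))
  · refine of_diag (-(q - q⁻¹)) ?_ (Or.inr ⟨his, hjt⟩)
    rw [hZ.diag s i t j his hjt, hZ.cross s i j t his hjt, neg_smul, add_neg_cancel_right]

theorem wordProd_perm (hq : q ≠ 0) {Z : Matrix (Fin n) (Fin n) R} (hZ : IsQuantumMatrix q Z)
    {l l' : List (AIndex n r)} (h : l.Perm l') :
    ∃ c : k, wordProd Z l - c • wordProd Z l' ∈ lowerSpan k r Z (wordWeight l) := by
  induction h with
  | nil => exact ⟨1, by simp⟩
  | @cons x l l' _ ih =>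
    obtain ⟨c, hc⟩ := ih
    have h₁ : wordProd Z (x :: l) - c • wordProd Z (x :: l') =
        wordProd Z [x] * (wordProd Z l - c • wordProd Z l') * wordProd (r := r) Z [] := by
      simp [wordProd, mul_sub]
    have h₂ : wordWeight (x :: l) = wordWeight [x] + wordWeight l + wordWeight (n := n) (r := r) [] := by
      simp [wordWeight]
    exact ⟨c, by rw [h₁, h₂]; exact mul_mem_lowerSpan Z [x] [] hc⟩
  | swap x y l =>
    obtain ⟨c, hc⟩ := wordProd_swap hq hZ y x
    have h₁ : wordProd Z (y :: x :: l) - c • wordProd Z (x :: y :: l) =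
        wordProd (r := r) Z [] * (wordProd Z [y, x] - c • wordProd Z [x, y]) * wordProd Z l := by
      simp [wordProd, sub_mul, mul_assoc]
    have h₂ : wordWeight (y :: x :: l) = wordWeight (n := n) (r := r) [] + wordWeight [y, x] + wordWeight l := by
      simp [wordWeight, add_assoc]
    exact ⟨c, by rw [h₁, h₂]; exact mul_mem_lowerSpan Z [] l hc⟩
  | @trans l₁ l₂ l₃ h₁ _ ih₁ ih₂ =>
    obtain ⟨c, hc⟩ := ih₁
    obtain ⟨d, hd⟩ := ih₂
    refine ⟨c * d, ?_⟩
    rw [← wordWeight_perm h₁] at hd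
    have := Submodule.add_mem _ hc (Submodule.smul_mem _ c hd)
    rwa [smul_sub, smul_smul, sub_add_sub_cancel] at this

theorem wordProd_mem_span (hq : q ≠ 0) {Z : Matrix (Fin n) (Fin n) R}
    (hZ : IsQuantumMatrix q Z) (l : List (AIndex n r)) :
    wordProd Z l ∈ Submodule.span k
      (Set.range fun m : Multiset (AIndex n r) => wordProd Z m.toList) := by
  induction hw : wordWeight l using Nat.strong_induction_on generalizing l with
  | _ w ih =>
    have hp : l.Perm (l : Multiset (AIndex n r)).toList :=
      Multiset.coe_eq_coe.1 (Multiset.coe_toList _).symm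
    obtain ⟨c, hc⟩ := wordProd_perm hq hZ hp
    have hle : lowerSpan k r Z (wordWeight l) ≤ Submodule.span k
        (Set.range fun m : Multiset (AIndex n r) => wordProd Z m.toList) := by
      refine Submodule.span_le.2 ?_
      rintro x ⟨l', hl', rfl⟩
      exact ih _ (hw ▸ hl') l' rfl
    have := Submodule.add_mem _ (hle hc) (Submodule.smul_mem _ c
      (Submodule.subset_span ⟨(l : Multiset (AIndex n r)), rfl⟩))
    rwa [sub_add_cancel] at this

end Straightening

section Final

variable {k : Type} [Field k] {q : k} {n r : ℕ}

theorem zgen_isQuantumMatrix : IsQuantumMatrix q (Matrix.of (Zgen k q n n)) where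
  row i j l h := by
    simpa [Zgen] using RingQuot.mkAlgHom_rel k (QMatRel.row (q := q) i j l h)
  col i s j h := by
    simpa [Zgen] using RingQuot.mkAlgHom_rel k (QMatRel.col (q := q) i s j h)
  cross i s j l h h' := by
    simpa [Zgen] using RingQuot.mkAlgHom_rel k (QMatRel.cross (q := q) i s j l h h')
  diag i s j l h h' := by
    simpa [Zgen] using RingQuot.mkAlgHom_rel k (QMatRel.diag (q := q) i s j l h h')

theorem mem_span_of_mem_asub (hq : q ≠ 0) {x : QMat k q n n} (hx : x ∈ Asub k q n r) :
    x ∈ Submodule.span k (Set.range fun m : Multiset (AIndex n r) =>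
      wordProd (Matrix.of (Zgen k q n n)) m.toList) := by
  rw [Asub, ← Subalgebra.mem_toSubmodule, Algebra.adjoin_eq_span] at hx
  refine Submodule.span_le.2 (fun y hy => ?_) hx
  obtain ⟨l, hl, rfl⟩ := Submonoid.exists_list_of_mem_closure hy
  have : ∃ l' : List (AIndex n r), wordProd (Matrix.of (Zgen k q n n)) l' = l.prod := by
    clear hy hx
    induction l with
    | nil => exact ⟨[], rfl⟩
    | cons z l ih =>
      obtain ⟨l', hl'⟩ := ih fun y hy => hl y (List.mem_cons_of_mem _ hy)
      obtain ⟨i, j, hij, rfl⟩ := hl z List.mem_cons_self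
      refine ⟨⟨(i, j), hij⟩ :: l', ?_⟩
      rw [List.prod_cons, ← hl']
      simp [wordProd]
  obtain ⟨l', hl'⟩ := this
  rw [SetLike.mem_coe, ← hl']
  exact wordProd_mem_span hq zgen_isQuantumMatrix l'

theorem exists_algHom_of_isQuantumMatrix {R : Type} [Ring R] [Algebra k R]
    {Z : Matrix (Fin n) (Fin n) R} (hZ : IsQuantumMatrix q Z) :
    ∃ Φ : QMat k q n n →ₐ[k] R, ∀ i j, Φ (Zgen k q n n i j) = Z i j := by
  refine ⟨RingQuot.liftAlgHom k ⟨FreeAlgebra.lift k fun p : Fin n × Fin n => Z p.1 p.2, ?_⟩, ?_⟩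
  · intro x y h
    induction h with
    | row i j l h => simpa using hZ.row i j l h
    | col i s j h => simpa using hZ.col i s j h
    | cross i s j l h h' => simpa using hZ.cross i s j l h h'
    | diag i s j l h h' => simpa using hZ.diag i s j l h h'
  · intro i j
    simp [Zgen]

theorem algHom_qMinor {R : Type} [Ring R] [Algebra k R] {Z : Matrix (Fin n) (Fin n) R}
    (Φ : QMat k q n n →ₐ[k] R) (hΦ : ∀ i j, Φ (Zgen k q n n i j) = Z i j) {t : ℕ}
    (ro co : Fin t → Fin n) : Φ (qMinor k q n n t ro co) = matrixMinor q Z ro co := by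
  simp [qMinor, matrixMinor, map_list_prod, List.map_ofFn, Function.comp_def, hΦ]

theorem exists_algHom_qMatRank {R : Type} [Ring R] [Algebra k R] (Φ : QMat k q n n →ₐ[k] R)
    (hΦ : ∀ x ∈ minorSet k q n (r + 1), Φ x = 0) :
    ∃ Ψ : QMatRank k q n r →ₐ[k] R, ∀ x, Ψ (rankProj k q n r x) = Φ x := by
  refine ⟨RingQuot.liftAlgHom k ⟨Φ, ?_⟩, fun x => RingQuot.liftAlgHom_mkAlgHom_apply _ _ _ _⟩
  rintro x y ⟨hx, rfl⟩
  rw [hΦ x hx, map_zero]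

end Final

/-- Let `k` have characteristic zero and let `q ≠ 0` be generic or a
primitive root of unity.  For `1 ≤ r ≤ n - 1`, the restriction of the quotient map
`M_q(n) → M^{r+1}_q(n)` to the subalgebra `A_{n,r}` is injective. -/
theorem rankProj_injOn_Asub
    (k : Type) [Field k] [CharZero k] (q : k) (hq0 : q ≠ 0)
    (hq : GenericOrRootOfUnity k q) (n r : ℕ) (hr : 1 ≤ r) (hrn : r + 1 ≤ n) :
    Function.Injective (fun a : Asub k q n r => rankProj k q n r (a : QMat k q n n)) := by
  obtain ⟨Φ, hΦ⟩ := exists_algHom_of_isQuantumMatrix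
    (fullPath_isQuantumMatrix (n := n) (r := r) hq0 n)
  have hminor : ∀ x ∈ minorSet k q n (r + 1), Φ x = 0 := by
    rintro x ⟨ro, co, -, hco, rfl⟩
    rw [algHom_qMinor (R := Module.End k (QExp →₀ k)) Φ hΦ, fullPath_matrixMinor hq0 n hco]
  obtain ⟨Ψ, hΨ⟩ := exists_algHom_qMatRank (R := Module.End k (QExp →₀ k)) Φ hminor
  have hlow : ∀ m : Multiset (AIndex n r),
      HasLowest (Φ (wordProd (Matrix.of (Zgen k q n n)) m.toList)) (m.map AIndex.hook).sum := by
    intro m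
    have := HasLowest.list_prod (T := fun p : AIndex n r => fullPath q n r n p.1.1 p.1.2)
      (α := AIndex.hook) (fun p => fullPath_hasLowest hq0 n p.1.1 p.1.2 p.2 (by lia)) m.toList
    rw [← Multiset.sum_coe, ← Multiset.map_coe, Multiset.coe_toList] at this
    simpa [wordProd, map_list_prod, Function.comp_def, hΦ] using this
  rintro ⟨a, ha⟩ ⟨b, hb⟩ hab
  have h0 : Φ (a - b) = 0 := by
    rw [map_sub, ← hΨ, ← hΨ]
    exact sub_eq_zero.2 (congrArg Ψ hab)
  obtain ⟨c, hc⟩ := Finsupp.mem_span_range_iff_exists_finsupp.1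
    (mem_span_of_mem_asub hq0 (Subalgebra.sub_mem _ ha hb))
  have hc0 : c = 0 := by
    refine eq_zero_of_hasLowest hlow (hook_sum_injective n r) c ?_
    rw [← h0, ← hc, Finsupp.sum, Finsupp.sum, map_sum]
    exact Finset.sum_congr rfl fun m _ => (map_smul Φ _ _).symm
  rw [hc0, Finsupp.sum_zero_index] at hc
  exact Subtype.ext (sub_eq_zero.1 hc.symm)
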